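/- arXiv:2209.06630 — 2 statements merged into one kernel-verified Lean document; each statement's English description precedes it below -/
import Mathlib

section
/- Let X, Y be Banach spaces and γ ∈ ℕ with γ ≥ 2. Suppose a ∈ C^γ(ℝ∖{0}; L(X,Y)) satisfies the Mihlin condition [a]_{𝔐_γ} := max_{0≤l≤γ} sup_{t≠0} ‖t^l a^{(l)}(t)‖ < ∞. Then the inverse Fourier transform of a (taken in the sense of tempered L(X,Y)-valued distributions) equals, on ℝ∖{0}, a function k ∈ C^{γ−2}(ℝ∖{0}; L(X,Y)) satisfying the Calderón–Zygmund kernel estimates [k]_{𝒦_{γ−2}} := max_{0≤l≤γ−2} sup_{t≠0} ‖t^{l+1} k^{(l)}(t)‖ ≤ C [a]_{𝔐_γ} with a constant C independent of a. -/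
open MeasureTheory Filter Topology Real SchwartzMap
open scoped FourierTransform

noncomputable section

section EulerBound

variable {E : Type*} [NormedAddCommGroup E] [NormedSpace ℝ E]

/-- The function `f` is `n` times differentiable on `ℝ∖{0}` and `‖(t d/dt)^j f‖ ≤ K` there for
all `j ≤ n`, the top derivative being continuous. -/
def EulerBound : ℕ → (ℝ → E) → ℝ → Prop
  | 0, f, K => ContinuousOn f {(0:ℝ)}ᶜ ∧ ∀ t : ℝ, t ≠ 0 → ‖f t‖ ≤ K
  | n + 1, f, K => DifferentiableOn ℝ f {(0:ℝ)}ᶜ ∧ (∀ t : ℝ, t ≠ 0 → ‖f t‖ ≤ K) ∧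
      EulerBound n (fun t => t • deriv f t) K

namespace EulerBound

lemma norm_le {n : ℕ} {f : ℝ → E} {K : ℝ} (h : EulerBound n f K) {t : ℝ} (ht : t ≠ 0) :
    ‖f t‖ ≤ K := by
  cases n with
  | zero => exact h.2 t ht
  | succ n => exact h.2.1 t ht

lemma continuousOn {n : ℕ} {f : ℝ → E} {K : ℝ} (h : EulerBound n f K) :
    ContinuousOn f {(0:ℝ)}ᶜ := by
  cases n with
  | zero => exact h.1
  | succ n => exact h.1.continuousOn

lemma hasDerivAt {n : ℕ} {f : ℝ → E} {K : ℝ} (h : EulerBound (n + 1) f K) {t : ℝ} (ht : t ≠ 0) :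
    HasDerivAt f (deriv f t) t :=
  (h.1.differentiableAt (isOpen_compl_singleton.mem_nhds ht)).hasDerivAt

lemma congr {n : ℕ} {f g : ℝ → E} {K : ℝ} (h : EulerBound n f K)
    (hfg : ∀ t : ℝ, t ≠ 0 → f t = g t) : EulerBound n g K := by
  induction n generalizing f g with
  | zero => exact ⟨h.1.congr fun t ht => (hfg t ht).symm, fun t ht => hfg t ht ▸ h.2 t ht⟩
  | succ n ih =>
    refine ⟨h.1.congr fun t ht => (hfg t ht).symm, fun t ht => hfg t ht ▸ h.2.1 t ht,
      ih h.2.2 fun t ht => ?_⟩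
    have : f =ᶠ[𝓝 t] g :=
      Filter.eventually_of_mem (isOpen_compl_singleton.mem_nhds ht) fun s hs => hfg s hs
    simp only [this.deriv_eq]

lemma mono {n : ℕ} {f : ℝ → E} {K L : ℝ} (h : EulerBound n f K) (hKL : K ≤ L) :
    EulerBound n f L := by
  induction n generalizing f with
  | zero => exact ⟨h.1, fun t ht => (h.2 t ht).trans hKL⟩
  | succ n ih => exact ⟨h.1, fun t ht => (h.2.1 t ht).trans hKL, ih h.2.2⟩

lemma of_succ {n : ℕ} {f : ℝ → E} {K : ℝ} (h : EulerBound (n + 1) f K) : EulerBound n f K := by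
  induction n generalizing f with
  | zero => exact ⟨h.continuousOn, h.2.1⟩
  | succ n ih => exact ⟨h.1, h.2.1, ih h.2.2⟩

lemma add {n : ℕ} {f g : ℝ → E} {K L : ℝ} (hf : EulerBound n f K) (hg : EulerBound n g L) :
    EulerBound n (fun t => f t + g t) (K + L) := by
  induction n generalizing f g with
  | zero => exact ⟨hf.1.add hg.1, fun t ht => norm_add_le_of_le (hf.2 t ht) (hg.2 t ht)⟩
  | succ n ih =>
    refine ⟨hf.1.add hg.1, fun t ht => norm_add_le_of_le (hf.2.1 t ht) (hg.2.1 t ht),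
      (ih hf.2.2 hg.2.2).congr fun t ht => ?_⟩
    rw [((hf.hasDerivAt ht).fun_add (hg.hasDerivAt ht)).deriv, smul_add]

lemma const_smul {n : ℕ} {f : ℝ → E} {K : ℝ} (hf : EulerBound n f K) (c : ℝ) :
    EulerBound n (fun t => c • f t) (|c| * K) := by
  have hb : ∀ {n : ℕ} {f : ℝ → E} {K : ℝ}, EulerBound n f K → ∀ t : ℝ, t ≠ 0 →
      ‖c • f t‖ ≤ |c| * K := fun h t ht => by
    rw [norm_smul, Real.norm_eq_abs]
    exact mul_le_mul_of_nonneg_left (h.norm_le ht) (abs_nonneg c)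
  induction n generalizing f with
  | zero => exact ⟨hf.1.const_smul c, hb hf⟩
  | succ n ih =>
    refine ⟨hf.1.const_smul c, hb hf, (ih hf.2.2).congr fun t ht => ?_⟩
    rw [((hf.hasDerivAt ht).fun_const_smul c).deriv, smul_comm]

end EulerBound

lemma hasDerivAt_abs_inv_mul_inv_pow (m : ℕ) {t : ℝ} (ht : t ≠ 0) :
    HasDerivAt (fun t : ℝ => |t|⁻¹ * t⁻¹ ^ m) (-(m + 1) * (|t|⁻¹ * t⁻¹ ^ (m + 1))) t := by
  have h1 := ((hasDerivAt_abs ht).fun_inv (abs_ne_zero.mpr ht)).fun_mul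
    (((hasDerivAt_id t).fun_inv ht).fun_pow m)
  refine h1.congr_deriv ?_
  have h2 : (SignType.sign t : ℝ) = |t| * t⁻¹ := by
    rw [eq_mul_inv_iff_mul_eq₀ ht, sign_mul_self]
  have h3 : |t| ≠ 0 := abs_ne_zero.mpr ht
  rw [h2]
  cases m with
  | zero => simp; field_simp; simp only [sq_abs]
  | succ m => simp; field_simp; simp only [sq_abs]; ring

/-- Derivative bounds for `f` divided by `|t| t^m`. -/
lemma EulerBound.abs_inv_mul_inv_pow_smul {N : ℕ} : ∀ {n m : ℕ} {f : ℝ → E} {K : ℝ}, 0 ≤ K →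
    n + m ≤ N → EulerBound n f K →
    ContDiffOn ℝ (n : ℕ∞) (fun t => (|t|⁻¹ * t⁻¹ ^ m) • f t) {(0:ℝ)}ᶜ ∧
    ∀ l ≤ n, ∀ t : ℝ, t ≠ 0 → |t| ^ (l + (m + 1)) *
      ‖iteratedDerivWithin l (fun t => (|t|⁻¹ * t⁻¹ ^ m) • f t) {(0:ℝ)}ᶜ t‖ ≤
        ((N:ℝ) + 1) ^ n * K := by
  have hbase : ∀ {m : ℕ} {f : ℝ → E} {K : ℝ} {t : ℝ}, t ≠ 0 → ‖f t‖ ≤ K →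
      |t| ^ (m + 1) * ‖(|t|⁻¹ * t⁻¹ ^ m) • f t‖ ≤ K := by
    intro m f K t ht h
    have h3 : |t| ≠ 0 := abs_ne_zero.mpr ht
    rw [norm_smul, norm_mul, norm_pow, norm_inv, norm_inv, Real.norm_eq_abs, Real.norm_eq_abs,
      abs_abs]
    have : |t| ^ (m + 1) * (|t|⁻¹ * |t|⁻¹ ^ m * ‖f t‖) = ‖f t‖ := by
      rw [← mul_assoc, ← pow_succ', ← mul_pow, mul_inv_cancel₀ h3, one_pow, one_mul]
    rwa [this]
  have hcont : ∀ m : ℕ, ContinuousOn (fun t : ℝ => |t|⁻¹ * t⁻¹ ^ m) {(0:ℝ)}ᶜ := fun m t ht =>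
    (hasDerivAt_abs_inv_mul_inv_pow m ht).continuousAt.continuousWithinAt
  intro n
  induction n with
  | zero =>
    intro m f K hK hN hf
    refine ⟨contDiffOn_zero.2 ((hcont m).smul hf.1), fun l hl t ht => ?_⟩
    obtain rfl : l = 0 := by omega
    simpa using hbase (m := m) ht (hf.2 t ht)
  | succ n ih =>
    intro m f K hK hN hf
    have hg : EulerBound n (fun t => t • deriv f t + (-((m:ℝ) + 1)) • f t) ((N + 1) * K) := by
      refine (hf.2.2.add (hf.of_succ.const_smul (-((m:ℝ) + 1)))).mono ?_
      rw [abs_neg, abs_of_nonneg (by positivity)]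
      have : (n:ℝ) + 1 + m ≤ N := by exact_mod_cast hN
      have hn : (0:ℝ) ≤ n := by positivity
      nlinarith
    have hder : ∀ t : ℝ, t ≠ 0 → HasDerivAt (fun t => (|t|⁻¹ * t⁻¹ ^ m) • f t)
        ((|t|⁻¹ * t⁻¹ ^ (m + 1)) • (t • deriv f t + (-((m:ℝ) + 1)) • f t)) t := by
      intro t ht
      refine ((hasDerivAt_abs_inv_mul_inv_pow m ht).fun_smul (hf.hasDerivAt ht)).congr_deriv ?_
      rw [smul_add, smul_smul, smul_smul]
      congr 2
      · rw [pow_succ, ← mul_assoc, mul_assoc _ t⁻¹ t, inv_mul_cancel₀ ht, mul_one]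
      · ring
    have hdw : Set.EqOn (derivWithin (fun t => (|t|⁻¹ * t⁻¹ ^ m) • f t) {(0:ℝ)}ᶜ)
        (fun t => (|t|⁻¹ * t⁻¹ ^ (m + 1)) • (t • deriv f t + (-((m:ℝ) + 1)) • f t)) {(0:ℝ)}ᶜ :=
      fun t ht => by
        rw [derivWithin_of_isOpen isOpen_compl_singleton ht, (hder t ht).deriv]
    obtain ⟨h1, h2⟩ := ih (m := m + 1) (by positivity) (by omega) hg
    constructor
    · have := contDiffOn_succ_iff_derivWithin (𝕜 := ℝ) (n := ((n : ℕ∞) : WithTop ℕ∞))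
        (f := fun t => (|t|⁻¹ * t⁻¹ ^ m) • f t)
        (isOpen_compl_singleton (x := (0:ℝ))).uniqueDiffOn
      push_cast at this ⊢
      refine this.2 ⟨fun t ht => (hder t ht).differentiableAt.differentiableWithinAt,
        fun h => absurd h (by simp), ?_⟩
      exact_mod_cast h1.congr hdw
    · intro l hl t ht
      cases l with
      | zero =>
        have hone : (1:ℝ) ≤ ((N:ℝ) + 1) ^ (n + 1) := one_le_pow₀ (by simp)
        simp only [iteratedDerivWithin_zero, zero_add]
        exact (hbase (m := m) ht (hf.norm_le ht)).trans (le_mul_of_one_le_left hK hone)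
      | succ l =>
        rw [iteratedDerivWithin_succ', iteratedDerivWithin_congr hdw ht]
        have := h2 l (by omega) t ht
        rw [show l + 1 + (m + 1) = l + (m + 1 + 1) by ring]
        exact this.trans_eq (by ring)

/-- The Mihlin condition bounds the iterated Euler derivatives of `t^m a^{(m)}`. -/
lemma EulerBound.of_mihlin {γ : ℕ} {a : ℝ → E} {K : ℝ} (ha : ContDiffOn ℝ (γ : ℕ∞) a {(0:ℝ)}ᶜ)
    (hK : 0 ≤ K)
    (hb : ∀ l ≤ γ, ∀ t : ℝ, t ≠ 0 → |t| ^ l * ‖iteratedDerivWithin l a {(0:ℝ)}ᶜ t‖ ≤ K) :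
    ∀ {n m : ℕ}, n + m ≤ γ →
      EulerBound n (fun t => t ^ m • iteratedDerivWithin m a {(0:ℝ)}ᶜ t)
        (((γ:ℝ) + 1) ^ n * K) := by
  have hnorm : ∀ m ≤ γ, ∀ t : ℝ, t ≠ 0 →
      ‖t ^ m • iteratedDerivWithin m a {(0:ℝ)}ᶜ t‖ ≤ K := fun m hm t ht => by
    rw [norm_smul, norm_pow, Real.norm_eq_abs]
    exact hb m hm t ht
  have hu : UniqueDiffOn ℝ ({(0:ℝ)}ᶜ : Set ℝ) :=
    (isOpen_compl_singleton (x := (0:ℝ))).uniqueDiffOn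
  intro n
  induction n with
  | zero =>
    intro m hm
    refine ⟨(continuous_pow m).continuousOn.smul
      (ha.continuousOn_iteratedDerivWithin (by exact_mod_cast (by omega : m ≤ γ)) hu), ?_⟩
    simpa using hnorm m (by omega)
  | succ n ih =>
    intro m hm
    have hder : ∀ t : ℝ, t ≠ 0 → HasDerivAt (iteratedDerivWithin m a {(0:ℝ)}ᶜ)
        (iteratedDerivWithin (m + 1) a {(0:ℝ)}ᶜ t) t := fun t ht => by
      have hd := ha.differentiableOn_iteratedDerivWithin (m := m)
        (by exact_mod_cast (by omega : m < γ)) hu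
      have hmem := isOpen_compl_singleton.mem_nhds (show t ∈ ({(0:ℝ)}ᶜ : Set ℝ) from ht)
      rw [iteratedDerivWithin_succ, derivWithin_of_isOpen isOpen_compl_singleton ht]
      exact (hd.differentiableAt hmem).hasDerivAt
    have hprod := fun t ht => ((hasDerivAt_pow m t).fun_smul (hder t ht))
    refine ⟨fun t ht => (hprod t ht).differentiableAt.differentiableWithinAt, fun t ht => ?_, ?_⟩
    · exact (hnorm m (by omega) t ht).trans
        (le_mul_of_one_le_left hK (one_le_pow₀ (by simp)))
    · refine (((ih (m := m) (by omega)).const_smul m).add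
        (ih (m := m + 1) (by omega))).congr (fun t ht => ?_) |>.mono ?_
      · rw [(hprod t ht).deriv, smul_add, smul_smul, smul_smul, smul_smul, add_comm,
          ← pow_succ']
        congr 2
        cases m with
        | zero => simp
        | succ m => simp only [Nat.add_sub_cancel]; ring
      · rw [Nat.abs_cast, pow_succ]
        have : (n:ℝ) + 1 + m ≤ γ := by exact_mod_cast hm
        have hn : (0:ℝ) ≤ n := by positivity
        have : 0 ≤ ((γ:ℝ) + 1) ^ n * K := by positivity
        nlinarith

end EulerBound

lemma ContinuousOn.aestronglyMeasurable_of_compl_zero {F : Type*} [NormedAddCommGroup F]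
    {f : ℝ → F} (hf : ContinuousOn f {(0:ℝ)}ᶜ) : AEStronglyMeasurable f volume := by
  have h := hf.aestronglyMeasurable (μ := volume) (measurableSet_singleton (0:ℝ)).compl
  rwa [Measure.restrict_eq_self_of_ae_mem (s := {(0:ℝ)}ᶜ) (Measure.ae_ne volume (0:ℝ))] at h

lemma ContinuousOn.comp_div_compl_zero {F : Type*} [TopologicalSpace F]
    {b : ℝ → F} (hb : ContinuousOn b {(0:ℝ)}ᶜ) {t : ℝ} (ht : t ≠ 0) :
    ContinuousOn (fun u => b (u / t)) {(0:ℝ)}ᶜ :=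
  hb.comp (continuous_id.div_const t).continuousOn fun _ hu => div_ne_zero hu ht

section Complex

variable {E : Type*} [NormedAddCommGroup E] [NormedSpace ℂ E]

lemma EulerBound.integral_smul_comp_div {w : ℝ → ℂ} (hw : Integrable w) {n : ℕ} {b : ℝ → E}
    {K : ℝ} (hb : EulerBound n b K) :
    EulerBound n (fun t => ∫ u, w u • b (u / t)) ((∫ u, ‖w u‖) * K) := by
  have hne : ∀ᵐ u : ℝ, u ≠ 0 := Measure.ae_ne volume 0
  have hmeas : ∀ {b : ℝ → E}, ContinuousOn b {(0:ℝ)}ᶜ → ∀ {t : ℝ}, t ≠ 0 →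
      AEStronglyMeasurable (fun u => w u • b (u / t)) volume := fun hb t ht =>
    hw.1.smul (hb.comp_div_compl_zero ht).aestronglyMeasurable_of_compl_zero
  have hnear : ∀ {t : ℝ}, t ≠ 0 → ∀ᶠ s in 𝓝 t, s ≠ 0 := fun ht => eventually_ne_nhds ht
  have hle : ∀ {n : ℕ} {b : ℝ → E} {K : ℝ}, EulerBound n b K → ∀ {t : ℝ}, t ≠ 0 →
      ∀ᵐ u : ℝ, ‖w u • b (u / t)‖ ≤ ‖w u‖ * K := fun hb t ht => by
    filter_upwards [hne] with u hu
    rw [norm_smul]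
    exact mul_le_mul_of_nonneg_left (hb.norm_le (div_ne_zero hu ht)) (norm_nonneg _)
  have hbound : ∀ {n : ℕ} {b : ℝ → E} {K : ℝ}, EulerBound n b K → ∀ t : ℝ, t ≠ 0 →
      ‖∫ u, w u • b (u / t)‖ ≤ (∫ u, ‖w u‖) * K := fun hb t ht => by
    rw [← integral_mul_const]
    exact norm_integral_le_of_norm_le (hw.norm.mul_const _) (hle hb ht)
  induction n generalizing b with
  | zero =>
    refine ⟨fun t ht => ContinuousAt.continuousWithinAt ?_, hbound hb⟩
    refine continuousAt_of_dominated (bound := fun u => ‖w u‖ * K)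
      ((hnear ht).mono fun s hs => hmeas hb.1 hs) ((hnear ht).mono fun s hs => hle hb hs)
      (hw.norm.mul_const _) ?_
    filter_upwards [hne] with u hu
    have hc : ContinuousAt b (u / t) :=
      hb.1.continuousAt (isOpen_compl_singleton.mem_nhds (div_ne_zero hu ht))
    exact continuousAt_const.smul
      (hc.comp_of_eq (continuousAt_const.div continuousAt_id ht) rfl)
  | succ n ih =>
    have hder : ∀ t : ℝ, t ≠ 0 → HasDerivAt (fun t => ∫ u, w u • b (u / t))
        (∫ u, w u • ((-t⁻¹) • ((u / t) • deriv b (u / t)))) t := fun t ht => by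
      have hcD := hb.2.2.continuousOn
      have hball : {s : ℝ | |t| / 2 < |s|} ∈ 𝓝 t :=
        (isOpen_lt continuous_const continuous_abs).mem_nhds
          (half_lt_self (abs_pos.mpr ht))
      have hs0 : ∀ s ∈ {s : ℝ | |t| / 2 < |s|}, s ≠ 0 := fun s hs =>
        abs_pos.mp ((by positivity : (0:ℝ) ≤ |t| / 2).trans_lt hs)
      refine (hasDerivAt_integral_of_dominated_loc_of_deriv_le
        (F' := fun s u => w u • ((-s⁻¹) • ((u / s) • deriv b (u / s))))
        (bound := fun u => ‖w u‖ * ((|t| / 2)⁻¹ * K)) hball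
        ((hnear ht).mono fun s hs => hmeas hb.continuousOn hs)
        ((hw.norm.mul_const K).mono' (hmeas hb.continuousOn ht) (hle hb ht))
        (hw.1.smul ((hcD.comp_div_compl_zero ht).aestronglyMeasurable_of_compl_zero.const_smul
          (-t⁻¹))) ?_ (hw.norm.mul_const _) ?_).2
      · filter_upwards [hne] with u hu s hs
        have h1 := hb.2.2.norm_le (div_ne_zero hu (hs0 s hs))
        have h2 : |s|⁻¹ ≤ (|t| / 2)⁻¹ := inv_anti₀ (by positivity) (le_of_lt hs)
        rw [norm_smul, norm_smul (-s⁻¹), norm_neg, norm_inv, Real.norm_eq_abs]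
        gcongr
      · filter_upwards [hne] with u hu s hs
        have hs := hs0 s hs
        have h1 := (hasDerivAt_inv hs).const_mul u
        have h2 := (hb.hasDerivAt (div_ne_zero hu hs)).scomp_of_eq s h1 (div_eq_mul_inv u s)
        refine (h2.const_smul (w u)).congr_deriv ?_
        rw [smul_smul (-s⁻¹)]
        congr 2
        field_simp
    refine ⟨fun t ht => (hder t ht).differentiableAt.differentiableWithinAt, hbound hb,
      ((ih hb.2.2).const_smul (-1)).congr (fun t ht => ?_) |>.mono (by simp)⟩
    rw [(hder t ht).deriv]
    simp_rw [smul_comm (w _) (-t⁻¹)]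
    rw [integral_smul, smul_smul]
    congr 1
    field_simp

section Kernels

/-- The Fourier character `u ↦ e^{2πiu}`. -/
def fourierExp (u : ℝ) : ℂ := Complex.exp ((2 * π * u : ℝ) * Complex.I)

/-- The function `(1 + u²)⁻¹`. -/
def cauchyWeight (u : ℝ) : ℝ := (1 + u ^ 2)⁻¹

/-- The function `e^{2πiu} / ((2πi)² (1 + u²))`. -/
def tailKernel (u : ℝ) : ℂ :=
  ((2 * π * Complex.I) ^ 2)⁻¹ * cauchyWeight u * fourierExp u

/-- The function `u² * tailKernel u`, in a form suited to differentiation. -/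
def tailPrimitive (u : ℝ) : ℂ :=
  ((2 * π * Complex.I) ^ 2)⁻¹ * (1 - cauchyWeight u) * fourierExp u

/-- The derivative of `tailPrimitive`. -/
def tailPrimitiveDeriv (u : ℝ) : ℂ :=
  ((2 * π * Complex.I) ^ 2)⁻¹ * (2 * u * cauchyWeight u ^ 2 +
    2 * π * Complex.I * (1 - cauchyWeight u)) * fourierExp u

/-- The second derivative of `tailPrimitive`. -/
def tailPrimitiveDeriv2 (u : ℝ) : ℂ :=
  ((2 * π * Complex.I) ^ 2)⁻¹ * (2 * cauchyWeight u ^ 2 - 8 * u ^ 2 * cauchyWeight u ^ 3 +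
    4 * (2 * π * Complex.I) * u * cauchyWeight u ^ 2 +
    (2 * π * Complex.I) ^ 2 * (1 - cauchyWeight u)) * fourierExp u

/-- The part of `e^{2πiu}` left after subtracting the second derivative of `tailPrimitive`. -/
def headKernel (u : ℝ) : ℂ := fourierExp u - tailPrimitiveDeriv2 u

lemma two_pi_I_ne_zero : (2 * π * Complex.I : ℂ) ≠ 0 := Complex.two_pi_I_ne_zero

lemma norm_fourierExp (u : ℝ) : ‖fourierExp u‖ = 1 := Complex.norm_exp_ofReal_mul_I _

lemma hasDerivAt_fourierExp (u : ℝ) :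
    HasDerivAt fourierExp (2 * π * Complex.I * fourierExp u) u := by
  have h := ((((hasDerivAt_id u).const_mul (2 * π)).ofReal_comp).mul_const Complex.I).cexp
  refine h.congr_deriv ?_
  simp only [fourierExp, id]
  push_cast
  ring

lemma cauchyWeight_pos (u : ℝ) : 0 < cauchyWeight u := by
  unfold cauchyWeight; positivity

lemma cauchyWeight_mul (u : ℝ) : cauchyWeight u * (1 + u ^ 2) = 1 :=
  inv_mul_cancel₀ (by positivity)

lemma cauchyWeight_le_one (u : ℝ) : cauchyWeight u ≤ 1 := by
  nlinarith [cauchyWeight_mul u, cauchyWeight_pos u,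
    mul_nonneg (cauchyWeight_pos u).le (sq_nonneg u)]

lemma abs_mul_cauchyWeight_le (u : ℝ) : |u| * cauchyWeight u ≤ 1 := by
  nlinarith [cauchyWeight_mul u, cauchyWeight_pos u, sq_abs u,
    mul_nonneg (cauchyWeight_pos u).le (sq_nonneg (|u| - 1))]

lemma sq_mul_cauchyWeight_le (u : ℝ) : u ^ 2 * cauchyWeight u ≤ 1 := by
  nlinarith [cauchyWeight_mul u, cauchyWeight_pos u]

lemma cauchyWeight_mul_le {δ t : ℝ} (hδ : 0 ≤ δ) (ht : δ ≤ |t|) (s : ℝ) :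
    cauchyWeight (t * s) ≤ cauchyWeight (δ * s) := by
  refine inv_anti₀ (by positivity) ?_
  rw [mul_pow, mul_pow, ← sq_abs t]
  gcongr

lemma integrable_cauchyWeight : Integrable cauchyWeight := integrable_inv_one_add_sq

lemma continuous_cauchyWeight : Continuous cauchyWeight :=
  (continuous_const.add (continuous_pow 2)).inv₀ fun u =>
    (by positivity : (0:ℝ) < 1 + u ^ 2).ne'

lemma continuous_fourierExp : Continuous fourierExp :=
  continuous_iff_continuousAt.2 fun u => (hasDerivAt_fourierExp u).continuousAt

lemma hasDerivAt_cauchyWeight (u : ℝ) :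
    HasDerivAt (fun u => (cauchyWeight u : ℂ)) (-2 * u * cauchyWeight u ^ 2) u := by
  have h : HasDerivAt cauchyWeight (-2 * u * cauchyWeight u ^ 2) u := by
    have h1 := ((hasDerivAt_pow 2 u).const_add 1).fun_inv
      (by positivity : (0:ℝ) < 1 + u ^ 2).ne'
    refine h1.congr_deriv ?_
    simp [cauchyWeight, div_eq_mul_inv]
  exact h.ofReal_comp.congr_deriv (by push_cast; ring)

lemma hasDerivAt_tailPrimitive (u : ℝ) :
    HasDerivAt tailPrimitive (tailPrimitiveDeriv u) u := by
  have h := (((hasDerivAt_cauchyWeight u).const_sub 1).const_mul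
    ((2 * π * Complex.I : ℂ) ^ 2)⁻¹).mul (hasDerivAt_fourierExp u)
  refine h.congr_deriv ?_
  unfold tailPrimitiveDeriv
  ring

lemma hasDerivAt_tailPrimitiveDeriv (u : ℝ) :
    HasDerivAt tailPrimitiveDeriv (tailPrimitiveDeriv2 u) u := by
  have hρ := hasDerivAt_cauchyWeight u
  have hu : HasDerivAt (fun u : ℝ => (u : ℂ)) 1 u := (hasDerivAt_id u).ofReal_comp
  have h := (((((hu.const_mul 2).fun_mul (hρ.fun_pow 2)).fun_add
    ((hρ.const_sub 1).const_mul (2 * π * Complex.I))).const_mul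
    ((2 * π * Complex.I : ℂ) ^ 2)⁻¹).mul (hasDerivAt_fourierExp u))
  refine h.congr_deriv ?_
  unfold tailPrimitiveDeriv2
  push_cast
  ring

lemma tailPrimitive_eq (u : ℝ) : tailPrimitive u = u ^ 2 * tailKernel u := by
  have h : (cauchyWeight u : ℂ) * (1 + u ^ 2) = 1 := by exact_mod_cast cauchyWeight_mul u
  unfold tailPrimitive tailKernel
  linear_combination (-((2 * π * Complex.I : ℂ) ^ 2)⁻¹ * fourierExp u) * h

lemma continuous_tailPrimitive : Continuous tailPrimitive :=
  continuous_iff_continuousAt.2 fun u => (hasDerivAt_tailPrimitive u).continuousAt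

lemma continuous_tailPrimitiveDeriv : Continuous tailPrimitiveDeriv :=
  continuous_iff_continuousAt.2 fun u => (hasDerivAt_tailPrimitiveDeriv u).continuousAt

lemma continuous_tailPrimitiveDeriv2 : Continuous tailPrimitiveDeriv2 := by
  have h1 := continuous_cauchyWeight
  have h2 := continuous_fourierExp
  unfold tailPrimitiveDeriv2
  fun_prop

lemma continuous_tailKernel : Continuous tailKernel := by
  have h1 := continuous_cauchyWeight
  have h2 := continuous_fourierExp
  unfold tailKernel
  fun_prop

lemma continuous_headKernel : Continuous headKernel :=
  continuous_fourierExp.sub continuous_tailPrimitiveDeriv2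

lemma norm_ofReal_cauchyWeight (u : ℝ) : ‖(cauchyWeight u : ℂ)‖ = cauchyWeight u := by
  rw [Complex.norm_real, Real.norm_of_nonneg (cauchyWeight_pos u).le]

lemma exists_norm_tailKernel_le : ∃ B, ∀ u, ‖tailKernel u‖ ≤ B * cauchyWeight u := by
  refine ⟨‖((2 * π * Complex.I : ℂ) ^ 2)⁻¹‖, fun u => ?_⟩
  rw [tailKernel, norm_mul, norm_mul, norm_fourierExp, norm_ofReal_cauchyWeight, mul_one]

lemma exists_norm_tailPrimitiveDeriv_sub_le : ∃ B, ∀ u,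
    ‖tailPrimitiveDeriv u - (2 * π * Complex.I)⁻¹ * fourierExp u‖ ≤ B * cauchyWeight u := by
  refine ⟨‖((2 * π * Complex.I : ℂ) ^ 2)⁻¹‖ * (2 + ‖(2 * π * Complex.I : ℂ)‖), fun u => ?_⟩
  have hw := two_pi_I_ne_zero
  have h : tailPrimitiveDeriv u - (2 * π * Complex.I)⁻¹ * fourierExp u =
      ((2 * π * Complex.I) ^ 2)⁻¹ * (2 * (u * cauchyWeight u) -
        2 * π * Complex.I) * cauchyWeight u * fourierExp u := by
    unfold tailPrimitiveDeriv
    field_simp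
    ring
  rw [h, norm_mul, norm_mul, norm_mul, norm_fourierExp, norm_ofReal_cauchyWeight, mul_one]
  have := (cauchyWeight_pos u).le
  gcongr
  refine (norm_sub_le _ _).trans ?_
  gcongr
  rw [norm_mul, norm_mul, norm_ofReal_cauchyWeight, Complex.norm_real, Real.norm_eq_abs,
    RCLike.norm_ofNat]
  linarith [abs_mul_cauchyWeight_le u]

lemma exists_norm_headKernel_le : ∃ B, ∀ u, ‖headKernel u‖ ≤ B * cauchyWeight u := by
  refine ⟨1 + ‖((2 * π * Complex.I : ℂ) ^ 2)⁻¹‖ * (10 + 4 * ‖(2 * π * Complex.I : ℂ)‖),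
    fun u => ?_⟩
  have hw := two_pi_I_ne_zero
  have h : headKernel u = (1 - ((2 * π * Complex.I) ^ 2)⁻¹ *
      (2 * cauchyWeight u - 8 * (u ^ 2 * cauchyWeight u) * cauchyWeight u +
        4 * (2 * π * Complex.I) * (u * cauchyWeight u))) * cauchyWeight u * fourierExp u := by
    unfold headKernel tailPrimitiveDeriv2
    field_simp
    ring
  rw [h, norm_mul, norm_mul, norm_fourierExp, norm_ofReal_cauchyWeight, mul_one]
  have hρ := (cauchyWeight_pos u).le
  gcongr
  refine (norm_sub_le _ _).trans ?_
  rw [norm_one, norm_mul]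
  gcongr
  refine (norm_add_le_of_le (norm_sub_le _ _) le_rfl).trans ?_
  have h1 := cauchyWeight_le_one u
  simp only [norm_mul, norm_pow, Complex.norm_real, Real.norm_eq_abs, RCLike.norm_ofNat, sq_abs,
    abs_of_nonneg hρ]
  have h2 : u ^ 2 * cauchyWeight u * cauchyWeight u ≤ 1 * 1 :=
    mul_le_mul (sq_mul_cauchyWeight_le u) h1 hρ zero_le_one
  have h3 : 4 * (2 * |π| * ‖Complex.I‖) * (|u| * cauchyWeight u) ≤
      4 * (2 * |π| * ‖Complex.I‖) * 1 := by
    gcongr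
    exact abs_mul_cauchyWeight_le u
  linarith

lemma exists_norm_tailPrimitiveDeriv2_le : ∃ B, ∀ u, ‖tailPrimitiveDeriv2 u‖ ≤ B := by
  obtain ⟨B, hB⟩ := exists_norm_headKernel_le
  refine ⟨1 + |B|, fun u => ?_⟩
  rw [show tailPrimitiveDeriv2 u = fourierExp u - headKernel u by simp [headKernel]]
  refine (norm_sub_le _ _).trans (add_le_add (norm_fourierExp u).le ((hB u).trans ?_))
  exact (mul_le_mul_of_nonneg_right (le_abs_self B) (cauchyWeight_pos u).le).trans
    (mul_le_of_le_one_right (abs_nonneg B) (cauchyWeight_le_one u))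

lemma exists_norm_tailPrimitiveDeriv_le : ∃ B, ∀ u, ‖tailPrimitiveDeriv u‖ ≤ B := by
  obtain ⟨B, hB⟩ := exists_norm_tailPrimitiveDeriv_sub_le
  refine ⟨|B| + ‖(2 * π * Complex.I : ℂ)⁻¹‖, fun u => ?_⟩
  rw [← sub_add_cancel (tailPrimitiveDeriv u) ((2 * π * Complex.I)⁻¹ * fourierExp u)]
  refine (norm_add_le _ _).trans (add_le_add ((hB u).trans ?_) ?_)
  · exact (mul_le_mul_of_nonneg_right (le_abs_self B) (cauchyWeight_pos u).le).trans
      (mul_le_of_le_one_right (abs_nonneg B) (cauchyWeight_le_one u))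
  · rw [norm_mul, norm_fourierExp, mul_one]

lemma exists_norm_tailPrimitive_le : ∃ B, ∀ u, ‖tailPrimitive u‖ ≤ B := by
  obtain ⟨B, hB⟩ := exists_norm_tailKernel_le
  have hB0 : 0 ≤ B := by
    have := (norm_nonneg _).trans (hB 0)
    exact nonneg_of_mul_nonneg_left this (cauchyWeight_pos 0)
  refine ⟨B, fun u => ?_⟩
  rw [tailPrimitive_eq, norm_mul, norm_pow, Complex.norm_real, Real.norm_eq_abs, sq_abs]
  nlinarith [hB u, sq_nonneg u, sq_mul_cauchyWeight_le u]

lemma integrable_of_norm_le_cauchyWeight {w : ℝ → ℂ} (hc : Continuous w)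
    (hw : ∃ B, ∀ u, ‖w u‖ ≤ B * cauchyWeight u) : Integrable w := by
  obtain ⟨B, hB⟩ := hw
  exact (integrable_cauchyWeight.const_mul B).mono' hc.aestronglyMeasurable
    (Eventually.of_forall hB)

end Kernels

section Duality

lemma norm_comp_mul_le {ψ w : ℝ → ℂ} {B δ : ℝ} (hδ : 0 ≤ δ) (hψ0 : ∀ t, |t| < δ → ψ t = 0)
    (hB : ∀ u, ‖w u‖ ≤ B * cauchyWeight u) (t s : ℝ) :
    ‖ψ t * w (t * s)‖ ≤ ‖ψ t‖ * (B * cauchyWeight (δ * s)) := by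
  rcases lt_or_ge |t| δ with h | h
  · simp [hψ0 t h]
  · have hB0 : 0 ≤ B :=
      nonneg_of_mul_nonneg_left ((norm_nonneg _).trans (hB 0)) (cauchyWeight_pos 0)
    rw [norm_mul]
    gcongr
    exact (hB _).trans (mul_le_mul_of_nonneg_left (cauchyWeight_mul_le hδ h s) hB0)

lemma norm_integral_comp_mul_le {ψ w : ℝ → ℂ} {B δ : ℝ} (hδ : 0 ≤ δ) (hψ : Integrable ψ)
    (hψ0 : ∀ t, |t| < δ → ψ t = 0) (hB : ∀ u, ‖w u‖ ≤ B * cauchyWeight u) (s : ℝ) :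
    ‖∫ t, ψ t * w (t * s)‖ ≤ (∫ t, ‖ψ t‖) * B * cauchyWeight (δ * s) := by
  rw [mul_assoc, ← integral_mul_const]
  exact norm_integral_le_of_norm_le (hψ.norm.mul_const _)
    (Eventually.of_forall fun t => norm_comp_mul_le hδ hψ0 hB t s)

variable {E : Type*} [NormedAddCommGroup E] [NormedSpace ℂ E]

lemma integral_comp_mul_smul_swap [CompleteSpace E] {ψ w : ℝ → ℂ} {b : ℝ → E} {δ K : ℝ}
    (hδ : 0 < δ)
    (hψ : Integrable ψ) (hψ0 : ∀ t, |t| < δ → ψ t = 0) (hw : Continuous w)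
    (hB : ∃ B, ∀ u, ‖w u‖ ≤ B * cauchyWeight u) (hb : AEStronglyMeasurable b volume)
    (hK : ∀ s, s ≠ 0 → ‖b s‖ ≤ K) :
    Integrable (fun s => (∫ t, ψ t * w (t * s)) • b s) ∧
    Integrable (fun t => ψ t • ∫ s, w (t * s) • b s) ∧
    ∫ s, (∫ t, ψ t * w (t * s)) • b s = ∫ t, ψ t • ∫ s, w (t * s) • b s := by
  obtain ⟨B, hB⟩ := hB
  have hne : ∀ᵐ s : ℝ, s ≠ 0 := Measure.ae_ne volume 0
  have hF : Integrable (Function.uncurry fun t s => (ψ t * w (t * s)) • b s)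
      (volume.prod volume) := by
    have hc := integrable_cauchyWeight.comp_mul_left' hδ.ne'
    refine (hψ.norm.mul_prod (hc.const_mul (B * K))).mono' ?_ ?_
    · refine AEStronglyMeasurable.smul (AEStronglyMeasurable.mul hψ.1.comp_fst ?_) hb.comp_snd
      exact (hw.comp (continuous_fst.mul continuous_snd)).aestronglyMeasurable
    · have : ∀ᵐ z : ℝ × ℝ ∂(volume.prod volume), z.2 ≠ 0 :=
        Measure.quasiMeasurePreserving_snd.ae hne
      filter_upwards [this] with z hz
      simp only [Function.uncurry]
      rw [norm_smul]
      refine (mul_le_mul (norm_comp_mul_le hδ.le hψ0 hB z.1 z.2) (hK _ hz) (norm_nonneg _)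
        ((norm_nonneg _).trans (norm_comp_mul_le hδ.le hψ0 hB z.1 z.2))).trans_eq ?_
      ring
  have h1 : ∀ s, ∫ t, (ψ t * w (t * s)) • b s = (∫ t, ψ t * w (t * s)) • b s := fun s =>
    integral_smul_const _ _
  have h2 : ∀ t, ∫ s, (ψ t * w (t * s)) • b s = ψ t • ∫ s, w (t * s) • b s := fun t => by
    simp_rw [mul_smul]
    exact integral_smul _ _
  refine ⟨?_, ?_, ?_⟩
  · simpa only [Function.uncurry, h1] using hF.integral_prod_right
  · simpa only [Function.uncurry, h2] using hF.integral_prod_left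
  · simpa only [h1, h2] using (integral_integral_swap hF).symm

lemma aestronglyMeasurable_mul_comp_mul {ψ w : ℝ → ℂ} (hψ : Integrable ψ) (hw : Continuous w)
    (s : ℝ) : AEStronglyMeasurable (fun t => ψ t * w (t * s)) volume :=
  hψ.1.mul (hw.comp (continuous_id.mul continuous_const)).aestronglyMeasurable

lemma integrable_mul_comp_mul {ψ w : ℝ → ℂ} (hψ : Integrable ψ) (hw : Continuous w)
    (hB : ∃ B, ∀ u, ‖w u‖ ≤ B) (s : ℝ) : Integrable fun t => ψ t * w (t * s) := by
  obtain ⟨B, hB⟩ := hB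
  refine (hψ.norm.mul_const B).mono' (aestronglyMeasurable_mul_comp_mul hψ hw s)
    (Eventually.of_forall fun t => ?_)
  rw [norm_mul]
  exact mul_le_mul_of_nonneg_left (hB _) (norm_nonneg _)

lemma hasDerivAt_integral_comp_mul {ψ ψ' V V' : ℝ → ℂ} (hψ : Integrable ψ)
    (hψ' : Integrable ψ') (hmul : ∀ t, ψ' t = ψ t * t) (hV : ∀ u, HasDerivAt V (V' u) u)
    (hVc : Continuous V) (hVc' : Continuous V') (hB : ∃ B, ∀ u, ‖V u‖ ≤ B)
    (hB' : ∃ B, ∀ u, ‖V' u‖ ≤ B) (s : ℝ) :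
    HasDerivAt (fun s => ∫ t, ψ t * V (t * s)) (∫ t, ψ' t * V' (t * s)) s := by
  obtain ⟨B', hB'⟩ := hB'
  refine (hasDerivAt_integral_of_dominated_loc_of_deriv_le
    (F' := fun s t => ψ' t * V' (t * s)) (bound := fun t => ‖ψ' t‖ * B') univ_mem
    (Eventually.of_forall fun s => aestronglyMeasurable_mul_comp_mul hψ hVc s)
    (integrable_mul_comp_mul hψ hVc hB s) (aestronglyMeasurable_mul_comp_mul hψ' hVc' s)
    (Eventually.of_forall fun t s _ => ?_) (hψ'.norm.mul_const B')
    (Eventually.of_forall fun t s _ => ?_)).2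
  · rw [norm_mul]
    exact mul_le_mul_of_nonneg_left (hB' _) (norm_nonneg _)
  · have h1 : HasDerivAt (fun s : ℝ => t * s) t s := by
      simpa using (hasDerivAt_id s).const_mul t
    refine (((hV (t * s)).scomp s h1).const_mul (ψ t)).congr_deriv ?_
    rw [hmul, Complex.real_smul]
    ring

lemma tendsto_cauchyWeight_cocompact {δ : ℝ} (hδ : 0 < δ) :
    Tendsto (fun s => cauchyWeight (δ * s)) (cocompact ℝ) (𝓝 0) := by
  have h : Tendsto (fun s : ℝ => 1 + (δ * s) ^ 2) (cocompact ℝ) atTop := by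
    refine tendsto_atTop_add_const_left _ _ ?_
    have h1 : Tendsto (fun s : ℝ => δ * ‖s‖) (cocompact ℝ) atTop :=
      (tendsto_norm_cocompact_atTop).const_mul_atTop hδ
    refine ((tendsto_pow_atTop two_ne_zero).comp h1).congr fun s => ?_
    simp [mul_pow]
  exact h.inv_tendsto_atTop

lemma fourierInv_eq_integral_fourierExp (f : ℝ → ℂ) (s : ℝ) :
    𝓕⁻ f s = ∫ t, f t * fourierExp (t * s) := by
  rw [Real.fourierInv_eq']
  refine integral_congr_ae (Eventually.of_forall fun t => ?_)
  simp only [fourierExp, smul_eq_mul]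
  rw [mul_comm (f t)]
  congr 3
  simp
  ring

lemma tendsto_integral_mul_fourierExp (f : ℝ → ℂ) :
    Tendsto (fun s => ∫ t, f t * fourierExp (t * s)) (cocompact ℝ) (𝓝 0) := by
  have h := (Real.zero_at_infty_fourier f).comp
    ((Homeomorph.neg ℝ).isClosedEmbedding.tendsto_cocompact)
  refine h.congr fun s => ?_
  rw [← fourierInv_eq_integral_fourierExp, Real.fourierInv_eq_fourier_neg]
  rfl

/-- Two integrations by parts on `ℝ` against a function `a` that is regular off the origin. -/
lemma integral_deriv2_smul_eq [CompleteSpace E] {P P' P'' : ℝ → ℂ} {a a' a'' : ℝ → E}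
    {K L δ : ℝ} (hδ : 0 < δ)
    (hP : ∀ s, HasDerivAt P (P' s) s) (hP' : ∀ s, HasDerivAt P' (P'' s) s)
    (ha : ∀ s, s ≠ 0 → HasDerivAt a (a' s) s) (ha' : ∀ s, s ≠ 0 → HasDerivAt a' (a'' s) s)
    (hPb : ∀ s, ‖P s‖ ≤ L * (s ^ 2 * cauchyWeight (δ * s))) (hP0 : P' 0 = 0)
    (hPinf : Tendsto P' (cocompact ℝ) (𝓝 0))
    (hab : ∀ s, s ≠ 0 → ‖a s‖ ≤ K) (hab' : ∀ s, s ≠ 0 → |s| * ‖a' s‖ ≤ K)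
    (hi1 : Integrable fun s => P'' s • a s) (hi2 : Integrable fun s => P s • a'' s) :
    ∫ s, P'' s • a s = ∫ s, P s • a'' s := by
  have hK : 0 ≤ K := (norm_nonneg _).trans (hab 1 one_ne_zero)
  have hL : 0 ≤ L := by
    have h := (norm_nonneg _).trans (hPb 1)
    exact nonneg_of_mul_nonneg_left h (by have := cauchyWeight_pos (δ * 1); positivity)
  have hP00 : P 0 = 0 := by simpa using hPb 0
  set H : ℝ → E := fun s => P' s • a s - P s • a' s with hH
  have hH0 : H 0 = 0 := by simp [hH, hP0, hP00]
  have hder : ∀ s, s ≠ 0 → HasDerivAt H (P'' s • a s - P s • a'' s) s := fun s hs => by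
    refine (((hP' s).smul (ha s hs)).sub ((hP s).smul (ha' s hs))).congr_deriv ?_
    abel
  have hbound : ∀ s, ‖H s‖ ≤ K * ‖P' s‖ + K * L * (|s| * cauchyWeight (δ * s)) := fun s => by
    have hρ := (cauchyWeight_pos (δ * s)).le
    rcases eq_or_ne s 0 with rfl | hs
    · rw [hH0, norm_zero]
      positivity
    · refine (norm_sub_le _ _).trans (add_le_add ?_ ?_)
      · rw [norm_smul, mul_comm]
        gcongr
        exact hab s hs
      · rw [norm_smul]
        calc ‖P s‖ * ‖a' s‖ ≤ L * (s ^ 2 * cauchyWeight (δ * s)) * ‖a' s‖ := by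
              gcongr
              exact hPb s
          _ = L * (|s| * cauchyWeight (δ * s)) * (|s| * ‖a' s‖) := by
              rw [← sq_abs]
              ring
          _ ≤ L * (|s| * cauchyWeight (δ * s)) * K := by
              gcongr
              exact hab' s hs
          _ = _ := by ring
  have hzero : ContinuousAt H 0 := by
    have hc : ContinuousAt (fun s => K * ‖P' s‖ + K * L * (|s| * cauchyWeight (δ * s))) 0 := by
      have h1 := (hP' 0).continuousAt
      have h2 : ContinuousAt (fun s => cauchyWeight (δ * s)) 0 :=
        (continuous_cauchyWeight.comp (continuous_const.mul continuous_id)).continuousAt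
      have h3 : ContinuousAt (fun s : ℝ => |s|) 0 := continuous_abs.continuousAt
      exact (continuousAt_const.mul h1.norm).add (continuousAt_const.mul (h3.mul h2))
    have ht := hc.tendsto
    simp only [hP0, norm_zero, abs_zero, zero_mul, mul_zero, add_zero] at ht
    rw [ContinuousAt, hH0]
    exact squeeze_zero_norm hbound ht
  have hinf : Tendsto H (cocompact ℝ) (𝓝 0) := by
    have h1 : Tendsto (fun s => |s| * cauchyWeight (δ * s)) (cocompact ℝ) (𝓝 0) := by
      have h2 : Tendsto (fun s : ℝ => (δ ^ 2)⁻¹ * ‖s‖⁻¹) (cocompact ℝ) (𝓝 ((δ ^ 2)⁻¹ * 0)) :=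
        (tendsto_norm_cocompact_atTop.inv_tendsto_atTop).const_mul _
      rw [mul_zero] at h2
      refine squeeze_zero (fun s => mul_nonneg (abs_nonneg s) (cauchyWeight_pos _).le)
        (fun s => ?_) h2
      rcases eq_or_ne s 0 with rfl | hs
      · simp
      · have hs' : 0 < |s| := abs_pos.mpr hs
        have h3 := sq_mul_cauchyWeight_le (δ * s)
        rw [Real.norm_eq_abs, ← mul_inv, ← one_div, le_div_iff₀ (by positivity)]
        calc |s| * cauchyWeight (δ * s) * (δ ^ 2 * |s|)
            = (δ * s) ^ 2 * cauchyWeight (δ * s) := by rw [mul_pow, ← sq_abs s]; ring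
          _ ≤ 1 := h3
    have := (hPinf.norm.const_mul K).add (h1.const_mul (K * L))
    simp only [norm_zero, mul_zero, add_zero] at this
    exact squeeze_zero_norm hbound this
  have hint : Integrable fun s => P'' s • a s - P s • a'' s := hi1.sub hi2
  have hpos := integral_Ioi_of_hasDerivAt_of_tendsto hzero.continuousWithinAt
    (fun s hs => hder s (ne_of_gt hs)) hint.integrableOn (hinf.mono_left atTop_le_cocompact)
  have hneg := integral_Iic_of_hasDerivAt_of_tendsto hzero.continuousWithinAt
    (fun s hs => hder s (ne_of_lt hs)) hint.integrableOn (hinf.mono_left atBot_le_cocompact)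
  rw [← sub_eq_zero, ← integral_sub hi1 hi2,
    ← intervalIntegral.integral_Iic_add_Ioi hint.integrableOn hint.integrableOn, hpos, hneg, hH0]
  simp

lemma integrable_div_ofReal {ψ : ℝ → ℂ} {δ : ℝ} (hδ : 0 < δ) (hψ : Integrable ψ)
    (hψ0 : ∀ t, |t| < δ → ψ t = 0) : Integrable fun t => ψ t / t := by
  simp_rw [div_eq_mul_inv]
  refine (hψ.norm.mul_const δ⁻¹).mono'
    (hψ.1.mul Complex.measurable_ofReal.inv.aestronglyMeasurable) (Eventually.of_forall fun t => ?_)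
  rcases lt_or_ge |t| δ with h | h
  · simp [hψ0 t h]
  · rw [norm_mul, norm_inv, Complex.norm_real, Real.norm_eq_abs]
    gcongr

/-- The inverse Fourier transform of a Mihlin multiplier, tested against functions supported away
from the origin. -/
lemma integral_fourierInv_smul_eq [CompleteSpace E] {φ : ℝ → ℂ} {a a' a'' : ℝ → E} {K δ : ℝ}
    (hδ : 0 < δ) (hφ : Integrable φ) (hφF : Integrable (𝓕⁻ φ)) (hφ0 : ∀ t, |t| < δ → φ t = 0)
    (hma : AEStronglyMeasurable a volume) (hma'' : AEStronglyMeasurable a'' volume)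
    (ha : ∀ s, s ≠ 0 → HasDerivAt a (a' s) s) (ha' : ∀ s, s ≠ 0 → HasDerivAt a' (a'' s) s)
    (hab : ∀ s, s ≠ 0 → ‖a s‖ ≤ K) (hab' : ∀ s, s ≠ 0 → |s| * ‖a' s‖ ≤ K)
    (hab'' : ∀ s, s ≠ 0 → ‖s ^ 2 • a'' s‖ ≤ K) :
    ∫ s, 𝓕⁻ φ s • a s = ∫ t, φ t • ((∫ s, headKernel (t * s) • a s) +
      ∫ s, tailKernel (t * s) • (s ^ 2 • a'' s)) := by
  have hφ1 := integrable_div_ofReal hδ hφ hφ0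
  have hdiv_zero : ∀ t, |t| < δ → φ t / t = 0 := fun t ht => by simp [hφ0 t ht]
  have hφ2 := integrable_div_ofReal hδ hφ1 hdiv_zero
  have hcancel : ∀ {ψ : ℝ → ℂ}, (∀ t, |t| < δ → ψ t = 0) → ∀ t, ψ t = ψ t / t * t :=
    fun {ψ} h t => by
    rcases eq_or_ne t 0 with rfl | ht
    · simp [h 0 (by simpa using hδ)]
    · rw [div_mul_cancel₀ _ (by exact_mod_cast ht)]
  obtain ⟨h1, h2, h3⟩ := integral_comp_mul_smul_swap hδ hφ hφ0 continuous_headKernel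
    exists_norm_headKernel_le hma hab
  obtain ⟨h4, h5, h6⟩ := integral_comp_mul_smul_swap (b := fun s => s ^ 2 • a'' s) hδ hφ hφ0
    continuous_tailKernel
    exists_norm_tailKernel_le ((continuous_pow 2).aestronglyMeasurable.smul hma'') hab''
  have hP : ∀ s, ∫ t, φ t / t / t * tailPrimitive (t * s) =
      s ^ 2 * ∫ t, φ t * tailKernel (t * s) := fun s => by
    rw [← integral_const_mul]
    refine integral_congr_ae (Eventually.of_forall fun t => ?_)
    simp only [tailPrimitive_eq]
    conv_rhs => rw [hcancel hφ0 t, hcancel hdiv_zero t]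
    push_cast
    ring
  have hsum : ∀ s, 𝓕⁻ φ s = (∫ t, φ t * headKernel (t * s)) +
      ∫ t, φ t * tailPrimitiveDeriv2 (t * s) := fun s => by
    rw [fourierInv_eq_integral_fourierExp, ← integral_add]
    · simp only [headKernel, ← mul_add, sub_add_cancel]
    · simp only [headKernel, mul_sub]
      exact (integrable_mul_comp_mul hφ continuous_fourierExp
        ⟨1, fun u => (norm_fourierExp u).le⟩ s).sub (integrable_mul_comp_mul hφ
        continuous_tailPrimitiveDeriv2 exists_norm_tailPrimitiveDeriv2_le s)
    · exact integrable_mul_comp_mul hφ continuous_tailPrimitiveDeriv2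
        exists_norm_tailPrimitiveDeriv2_le s
  have hFa : Integrable fun s => 𝓕⁻ φ s • a s := by
    refine (hφF.norm.mul_const K).mono' (hφF.1.smul hma) ?_
    filter_upwards [Measure.ae_ne volume (0:ℝ)] with s hs
    rw [norm_smul]
    exact mul_le_mul_of_nonneg_left (hab s hs) (norm_nonneg _)
  have hi1 : Integrable fun s => (∫ t, φ t * tailPrimitiveDeriv2 (t * s)) • a s := by
    refine (hFa.sub h1).congr (Eventually.of_forall fun s => ?_)
    simp [hsum s, add_smul]
  have hPeq : ∀ s, (∫ t, φ t / t / t * tailPrimitive (t * s)) • a'' s =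
      (∫ t, φ t * tailKernel (t * s)) • (s ^ 2 • a'' s) := fun s => by
    rw [hP, mul_comm, mul_smul]
    congr 1
    rw [← Complex.coe_smul]
    push_cast
    rfl
  have hi2 : Integrable fun s => (∫ t, φ t / t / t * tailPrimitive (t * s)) • a'' s := by
    simpa only [hPeq] using h4
  have hparts := integral_deriv2_smul_eq hδ
    (hasDerivAt_integral_comp_mul hφ2 hφ1 (hcancel hdiv_zero) hasDerivAt_tailPrimitive
      continuous_tailPrimitive continuous_tailPrimitiveDeriv exists_norm_tailPrimitive_le
      exists_norm_tailPrimitiveDeriv_le)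
    (hasDerivAt_integral_comp_mul hφ1 hφ (hcancel hφ0) hasDerivAt_tailPrimitiveDeriv
      continuous_tailPrimitiveDeriv continuous_tailPrimitiveDeriv2
      exists_norm_tailPrimitiveDeriv_le exists_norm_tailPrimitiveDeriv2_le)
    ha ha' (L := (∫ t, ‖φ t‖) * exists_norm_tailKernel_le.choose) (fun s => ?_) ?_ ?_
    hab hab' hi1 hi2
  · simp_rw [hsum, add_smul, smul_add]
    rw [integral_add h1 hi1, integral_add h2 h5, h3, ← h6, hparts]
    simp_rw [hPeq]
  · rw [hP, norm_mul, norm_pow, Complex.norm_real, Real.norm_eq_abs, sq_abs]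
    refine (mul_le_mul_of_nonneg_left (norm_integral_comp_mul_le hδ.le hφ hφ0
      exists_norm_tailKernel_le.choose_spec s) (sq_nonneg s)).trans_eq (by ring)
  · simp [tailPrimitiveDeriv, cauchyWeight]
  · obtain ⟨B, hB⟩ := exists_norm_tailPrimitiveDeriv_sub_le
    have hres : Tendsto (fun s => ∫ t, φ t / t * (tailPrimitiveDeriv (t * s) -
        (2 * π * Complex.I)⁻¹ * fourierExp (t * s))) (cocompact ℝ) (𝓝 0) := by
      refine squeeze_zero_norm (fun s => norm_integral_comp_mul_le hδ.le hφ1 hdiv_zero hB s) ?_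
      simpa using (tendsto_cauchyWeight_cocompact hδ).const_mul ((∫ t : ℝ, ‖φ t / t‖) * B)
    have hosc := (tendsto_integral_mul_fourierExp fun t => φ t / t).const_mul
      ((2 * π * Complex.I : ℂ)⁻¹)
    have hadd := hres.add hosc
    rw [mul_zero, add_zero] at hadd
    refine hadd.congr fun s => ?_
    have he := integrable_mul_comp_mul hφ1 continuous_fourierExp
      ⟨1, fun u => (norm_fourierExp u).le⟩ s
    have hd := integrable_mul_comp_mul hφ1 continuous_tailPrimitiveDeriv
      exists_norm_tailPrimitiveDeriv_le s
    rw [← integral_const_mul, ← integral_add]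
    · refine integral_congr_ae (Eventually.of_forall fun t => ?_)
      ring
    · refine (hd.sub (he.const_mul ((2 * π * Complex.I : ℂ)⁻¹))).congr
        (Eventually.of_forall fun t => ?_)
      simp only [Pi.sub_apply]
      ring
    · exact he.const_mul _

lemma integral_comp_mul_smul_eq (w : ℝ → ℂ) (b : ℝ → E) {t : ℝ} (ht : t ≠ 0) :
    ∫ s, w (t * s) • b s = |t|⁻¹ • ∫ u, w u • b (u / t) := by
  rw [← abs_inv, ← Measure.integral_comp_mul_left (fun u => w u • b (u / t)) t]
  simp_rw [mul_div_cancel_left₀ _ ht]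

end Duality

end Complex


/-- (Vector-valued version of Stein, Proposition 4.4.2(a).) For every `γ ≥ 2`
there is a constant `C` such that for all Banach spaces `X, Y` and every
`a ∈ C^γ(ℝ∖{0}; L(X,Y))` satisfying the Mihlin condition
`[a]_{𝔐_γ} = max_{l ≤ γ} sup_{t ≠ 0} ‖t^l a^{(l)}(t)‖ ≤ K`, the distributional inverse Fourier
transform of `a` agrees on `ℝ∖{0}` with a function `k ∈ C^{γ-2}(ℝ∖{0}; L(X,Y))` satisfying the
Calderón–Zygmund estimates `max_{l ≤ γ-2} sup_{t ≠ 0} ‖t^{l+1} k^{(l)}(t)‖ ≤ C·K`. -/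
theorem statement6 (γ : ℕ) (hγ : 2 ≤ γ) :
    ∃ C : ℝ, 0 < C ∧
      ∀ (X Y : Type) [NormedAddCommGroup X] [NormedSpace ℂ X] [NormedAddCommGroup Y]
        [NormedSpace ℂ Y] [CompleteSpace Y]
        (a : ℝ → X →L[ℂ] Y) (K : ℝ),
        AEStronglyMeasurable a volume →
        ContDiffOn ℝ (γ : ℕ∞) a {(0:ℝ)}ᶜ →
        (∀ l ≤ γ, ∀ t : ℝ, t ≠ 0 →
          |t| ^ l * ‖iteratedDerivWithin l a {(0:ℝ)}ᶜ t‖ ≤ K) →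
        ∃ k : ℝ → X →L[ℂ] Y,
          ContDiffOn ℝ ((γ - 2 : ℕ) : ℕ∞) k {(0:ℝ)}ᶜ ∧
          (∀ l ≤ γ - 2, ∀ t : ℝ, t ≠ 0 →
            |t| ^ (l + 1) * ‖iteratedDerivWithin l k {(0:ℝ)}ᶜ t‖ ≤ C * K) ∧
          ∀ φ : 𝓢(ℝ, ℂ), tsupport (fun t => φ t) ⊆ {(0:ℝ)}ᶜ →
            ∫ t, (𝓕⁻ (fun s => φ s) t) • a t = ∫ t, φ t • k t := by
  set W : ℝ := (∫ u, ‖headKernel u‖) + ∫ u, ‖tailKernel u‖ with hW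
  have hW0 : 0 ≤ W := by positivity
  refine ⟨((γ:ℝ) + 1) ^ (γ - 2) * ((W + 1) * ((γ:ℝ) + 1) ^ (γ - 2)), by positivity, ?_⟩
  intro X Y _ _ _ _ _ a K hma ha hb
  have hK : 0 ≤ K := by
    refine (norm_nonneg (a 1)).trans ?_
    simpa using hb 0 (by omega) 1 one_ne_zero
  have hu : UniqueDiffOn ℝ ({(0:ℝ)}ᶜ : Set ℝ) :=
    (isOpen_compl_singleton (x := (0:ℝ))).uniqueDiffOn
  have hder : ∀ m < γ, ∀ t : ℝ, t ≠ 0 → HasDerivAt (iteratedDerivWithin m a {(0:ℝ)}ᶜ)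
      (iteratedDerivWithin (m + 1) a {(0:ℝ)}ᶜ t) t := fun m hm t ht => by
    have hd := ha.differentiableOn_iteratedDerivWithin (m := m) (by exact_mod_cast hm) hu
    rw [iteratedDerivWithin_succ, derivWithin_of_isOpen isOpen_compl_singleton ht]
    exact (hd.differentiableAt (isOpen_compl_singleton.mem_nhds ht)).hasDerivAt
  have ha2 : ContinuousOn (iteratedDerivWithin 2 a {(0:ℝ)}ᶜ) {(0:ℝ)}ᶜ := by
    have hcont : ∀ m ≤ γ, ContinuousOn (iteratedDerivWithin m a {(0:ℝ)}ᶜ) {(0:ℝ)}ᶜ :=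
      fun m hm => ha.continuousOn_iteratedDerivWithin (by exact_mod_cast hm) hu
    exact hcont 2 hγ
  set b : ℝ → X →L[ℂ] Y := fun t => t ^ 2 • iteratedDerivWithin 2 a {(0:ℝ)}ᶜ t with hbdef
  have hE0 : EulerBound (γ - 2) a (((γ:ℝ) + 1) ^ (γ - 2) * K) :=
    (EulerBound.of_mihlin ha hK hb (n := γ - 2) (m := 0) (by omega)).congr (by simp)
  have hE2 : EulerBound (γ - 2) b (((γ:ℝ) + 1) ^ (γ - 2) * K) :=
    EulerBound.of_mihlin ha hK hb (n := γ - 2) (m := 2) (by omega)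
  have hE := ((hE0.integral_smul_comp_div (integrable_of_norm_le_cauchyWeight
    continuous_headKernel exists_norm_headKernel_le)).add
    (hE2.integral_smul_comp_div (integrable_of_norm_le_cauchyWeight
    continuous_tailKernel exists_norm_tailKernel_le))).mono
    (show _ ≤ (W + 1) * (((γ:ℝ) + 1) ^ (γ - 2) * K) by
      rw [← add_mul, ← hW]
      gcongr
      linarith)
  obtain ⟨hk1, hk2⟩ := hE.abs_inv_mul_inv_pow_smul (N := γ) (m := 0) (by positivity) (by omega)
  refine ⟨_, hk1, fun l hl t ht => (hk2 l hl t ht).trans_eq (by ring), fun φ hφ => ?_⟩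
  obtain ⟨δ, hδ, hφ0⟩ : ∃ δ > 0, ∀ t, |t| < δ → φ t = 0 := by
    have h0 : (0:ℝ) ∉ tsupport (fun t => φ t) := fun h => hφ h rfl
    obtain ⟨δ, hδ, h⟩ := Metric.eventually_nhds_iff.1 (notMem_tsupport_iff_eventuallyEq.1 h0)
    exact ⟨δ, hδ, fun t ht => h (by simpa using ht)⟩
  have hφF : Integrable (𝓕⁻ (fun s => φ s)) := by
    have h := (𝓕⁻ φ).integrable (μ := volume)
    rwa [SchwartzMap.fourierInv_coe] at h
  rw [integral_fourierInv_smul_eq (K := K) hδ φ.integrable hφF hφ0 hma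
    ha2.aestronglyMeasurable_of_compl_zero
    (fun s hs => by simpa using hder 0 (by omega) s hs) (fun s hs => hder 1 (by omega) s hs)
    (fun s hs => by simpa using hb 0 (by omega) s hs)
    (fun s hs => by simpa using hb 1 (by omega) s hs)
    (fun s hs => by simpa [norm_smul] using hb 2 hγ s hs)]
  refine integral_congr_ae ?_
  filter_upwards [Measure.ae_ne volume (0:ℝ)] with t ht
  rw [integral_comp_mul_smul_eq headKernel a ht, integral_comp_mul_smul_eq tailKernel b ht,
    ← smul_add]
  simp
end
end

section
/- Let X, Y be Banach spaces with Y continuously embedded in X, and let C be a closed linear operator on X whose domain (with graph norm) contains Y continuously. Suppose u ∈ L¹_loc(ℝ; Y) is such that the distributional derivatives ∂u and ∂(Cu) are both regular X-valued distributions, i.e. ∂u, ∂(Cu) ∈ L¹_loc(ℝ; X). Then for almost every t ∈ ℝ the strong derivative u'(t) exists in X, u'(t) belongs to the domain of C, and C u'(t) = (∂(Cu))(t). -/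
open MeasureTheory Filter Topology

noncomputable section

section DuBoisReymond

theorem MeasureTheory.LocallyIntegrable.prodMk {α E F : Type*} [TopologicalSpace α]
    [MeasurableSpace α] {μ : Measure α} [NormedAddCommGroup E] [NormedAddCommGroup F]
    {f : α → E} {g : α → F} (hf : LocallyIntegrable f μ) (hg : LocallyIntegrable g μ) :
    LocallyIntegrable (fun x ↦ (f x, g x)) μ := by
  intro x
  obtain ⟨s, hs, hfs⟩ := hf x
  obtain ⟨t, ht, hgt⟩ := hg x
  exact ⟨s ∩ t, inter_mem hs ht,
    (hfs.mono_set Set.inter_subset_left).integrable.prodMk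
      (hgt.mono_set Set.inter_subset_right).integrable⟩

theorem MeasureTheory.LocallyIntegrable.intervalIntegrable {E : Type*} [NormedAddCommGroup E]
    {g : ℝ → E} (hg : LocallyIntegrable g volume) (a b : ℝ) : IntervalIntegrable g volume a b :=
  intervalIntegrable_iff.mpr <|
    (hg.integrableOn_isCompact isCompact_uIcc).mono_set Set.uIoc_subset_uIcc

variable {E : Type*} [NormedAddCommGroup E] [NormedSpace ℝ E]

theorem HasCompactSupport.exists_tsupport_subset_Ioo {M : Type*} [Zero M] {φ : ℝ → M}
    (hφ : HasCompactSupport φ) :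
    ∃ R : ℝ, tsupport φ ⊆ Set.Ioo (-R) R := by
  obtain ⟨R, h⟩ := hφ.isBounded.subset_ball 0
  exact ⟨R, by simpa [Real.ball_eq_Ioo] using h⟩

/-- Primitives of locally integrable vector-valued functions are absolutely continuous. -/
theorem MeasureTheory.LocallyIntegrable.absolutelyContinuousOnInterval_primitive {g : ℝ → E}
    (hg : LocallyIntegrable g volume) (c a b : ℝ) :
    AbsolutelyContinuousOnInterval (fun x ↦ ∫ t in c..x, g t) a b := by
  have hnorm : LocallyIntegrable (fun t ↦ ‖g t‖) volume := fun x ↦ (hg x).norm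
  have key := (hnorm.intervalIntegrable a b).absolutelyContinuousOnInterval_intervalIntegral
    (c := a) Set.left_mem_uIcc
  refine squeeze_zero (fun t ↦ Finset.sum_nonneg fun i _ ↦ dist_nonneg) (fun t ↦ ?_) key
  refine Finset.sum_le_sum fun i _ ↦ ?_
  rw [dist_comm, dist_comm (∫ v in a..(t.2 i).1, ‖g v‖), dist_eq_norm, dist_eq_norm,
    intervalIntegral.integral_interval_sub_left (hg.intervalIntegrable _ _)
      (hg.intervalIntegrable _ _),
    intervalIntegral.integral_interval_sub_left (hnorm.intervalIntegrable _ _)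
      (hnorm.intervalIntegrable _ _)]
  exact intervalIntegral.norm_integral_le_abs_integral_norm

/-- The primitive of a locally integrable function `g` has distributional derivative `g`. -/
theorem MeasureTheory.LocallyIntegrable.integral_deriv_smul_primitive [CompleteSpace E]
    {g : ℝ → E} (hg : LocallyIntegrable g volume) (c : ℝ) {φ : ℝ → ℝ} (hφ : ContDiff ℝ 1 φ)
    (hφc : HasCompactSupport φ) :
    ∫ t, deriv φ t • (∫ s in c..t, g s) = -∫ t, φ t • g t := by
  obtain ⟨R, hsupp⟩ := hφc.exists_tsupport_subset_Ioo
  have hzero : ∀ t ∉ Set.Ioo (-R) R, φ t = 0 := fun t ht ↦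
    image_eq_zero_of_notMem_tsupport fun h ↦ ht (hsupp h)
  set G : ℝ → E := fun t ↦ ∫ s in c..t, g s
  have hGcont : Continuous G :=
    intervalIntegral.continuous_primitive hg.intervalIntegrable c
  have h_int₁ : Integrable (fun t ↦ deriv φ t • G t) :=
    hGcont.locallyIntegrable.integrable_smul_left_of_hasCompactSupport
      (hφ.continuous_deriv le_rfl) hφc.deriv
  have h_int₂ : Integrable (fun t ↦ φ t • g t) :=
    hg.integrable_smul_left_of_hasCompactSupport hφ.continuous hφc
  set k : ℝ → E := fun t ↦ deriv φ t • G t + φ t • g t with hk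
  have hk_int : Integrable k := h_int₁.add h_int₂
  have hac : AbsolutelyContinuousOnInterval
      (fun x ↦ φ x • G x - ∫ t in (-R)..x, k t) (-R) R :=
    (hφ.contDiffOn.absolutelyContinuousOnInterval.fun_smul
      (hg.absolutelyContinuousOnInterval_primitive c _ _)).fun_sub
      (hk_int.locallyIntegrable.absolutelyContinuousOnInterval_primitive _ _ _)
  obtain ⟨d, hd⟩ := hac.const_of_ae_hasDerivAt_zero (by
    filter_upwards [_root_.LocallyIntegrable.ae_hasDerivAt_integral hg,
      _root_.LocallyIntegrable.ae_hasDerivAt_integral hk_int.locallyIntegrable]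
      with x hx hkx _
    have hφx : HasDerivAt φ (deriv φ x) x := (hφ.differentiable one_ne_zero x).hasDerivAt
    exact ((hφx.smul (hx c)).sub (hkx (-R))).congr_deriv (sub_eq_zero.mpr (add_comm _ _)))
  have hleft := hd (-R) Set.left_mem_uIcc
  have hright := hd R Set.right_mem_uIcc
  simp only [hzero (-R) (by simp), hzero R (by simp), zero_smul,
    intervalIntegral.integral_same, sub_zero, zero_sub] at hleft hright
  have hk_supp : Function.support k ⊆ Set.Ioc (-R) R := by
    refine Function.support_subset_iff'.mpr fun t ht ↦ ?_
    have ht' : t ∉ tsupport φ := fun h ↦ ht (Set.Ioo_subset_Ioc_self (hsupp h))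
    have hdt : deriv φ t = 0 := by
      by_contra h
      exact ht' (support_deriv_subset h)
    simp [hk, image_eq_zero_of_notMem_tsupport ht', hdt]
  rw [intervalIntegral.integral_eq_integral_of_support_subset hk_supp, ← hleft, neg_eq_zero,
    hk, integral_add h_int₁ h_int₂] at hright
  exact eq_neg_of_add_eq_zero_left hright

/-- A smooth compactly supported function with zero integral is the derivative of a smooth
compactly supported function. -/
theorem HasCompactSupport.exists_deriv_eq_of_integral_eq_zero {ψ : ℝ → ℝ}
    (hψc : HasCompactSupport ψ) (hψ : ContDiff ℝ (⊤ : ℕ∞) ψ) (hzero : ∫ t, ψ t = 0) :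
    ∃ φ : ℝ → ℝ, ContDiff ℝ (⊤ : ℕ∞) φ ∧ HasCompactSupport φ ∧ deriv φ = ψ := by
  obtain ⟨R, hsupp⟩ := hψc.exists_tsupport_subset_Ioo
  have hψ0 : ∀ t ∉ Set.Ioo (-R) R, ψ t = 0 := fun t ht ↦
    image_eq_zero_of_notMem_tsupport fun h ↦ ht (hsupp h)
  have hd : ∀ x, HasDerivAt (fun x ↦ ∫ t in (-R)..x, ψ t) (ψ x) x := fun x ↦
    (hψ.continuous.integral_hasStrictDerivAt (-R) x).hasDerivAt
  have hderiv : deriv (fun x ↦ ∫ t in (-R)..x, ψ t) = ψ := funext fun x ↦ (hd x).deriv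
  refine ⟨fun x ↦ ∫ t in (-R)..x, ψ t, ?_, ?_, hderiv⟩
  · rw [contDiff_infty_iff_deriv, hderiv]
    exact ⟨fun x ↦ (hd x).differentiableAt, hψ⟩
  · refine HasCompactSupport.intro (isCompact_Icc (a := -R) (b := R)) fun x hx ↦ ?_
    rcases lt_or_ge x (-R) with h | h
    · rw [intervalIntegral.integral_congr (g := fun _ ↦ 0), intervalIntegral.integral_zero]
      intro t ht
      rw [Set.uIcc_of_ge h.le] at ht
      exact hψ0 t fun h' ↦ absurd h'.1 ht.2.not_gt
    · have hR : R < x := by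
        by_contra h'
        exact hx ⟨h, not_lt.mp h'⟩
      rw [← hzero]
      refine intervalIntegral.integral_eq_integral_of_support_subset fun t ht ↦ ?_
      have := hsupp (subset_tsupport ψ ht)
      exact ⟨this.1, this.2.le.trans hR.le⟩

theorem exists_contDiff_hasCompactSupport_integral_eq_one :
    ∃ ρ : ℝ → ℝ, ContDiff ℝ (⊤ : ℕ∞) ρ ∧ HasCompactSupport ρ ∧ ∫ t, ρ t = 1 := by
  let B : ContDiffBump (0 : ℝ) := ⟨1, 2, one_pos, one_lt_two⟩
  exact ⟨B.normed volume, B.contDiff_normed, B.hasCompactSupport_normed, B.integral_normed⟩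

/-- A locally integrable function with vanishing distributional derivative is a.e. constant. -/
theorem MeasureTheory.LocallyIntegrable.ae_eq_const_of_integral_deriv_smul_eq_zero
    [CompleteSpace E] {h : ℝ → E} (hh : LocallyIntegrable h volume)
    (hd : ∀ φ : ℝ → ℝ, ContDiff ℝ (⊤ : ℕ∞) φ → HasCompactSupport φ →
      ∫ t, deriv φ t • h t = 0) :
    ∃ c : E, ∀ᵐ t, h t = c := by
  obtain ⟨ρ, hρ, hρc, hρ1⟩ := exists_contDiff_hasCompactSupport_integral_eq_one
  refine ⟨∫ t, ρ t • h t, ae_eq_of_integral_contDiff_smul_eq hh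
    (locallyIntegrable_const _) fun ψ hψ hψc ↦ ?_⟩
  have hρ_int : Integrable ρ := hρ.continuous.integrable_of_hasCompactSupport hρc
  have hψ_int : Integrable ψ := hψ.continuous.integrable_of_hasCompactSupport hψc
  have hρh : Integrable (fun t ↦ ρ t • h t) :=
    hh.integrable_smul_left_of_hasCompactSupport hρ.continuous hρc
  have hψh : Integrable (fun t ↦ ψ t • h t) :=
    hh.integrable_smul_left_of_hasCompactSupport hψ.continuous hψc
  set m : ℝ := ∫ s, ψ s
  have hmρc : HasCompactSupport (fun t ↦ m * ρ t) := hρc.mul_left (f := fun _ ↦ m)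
  have hzero : ∫ t, (ψ t - m * ρ t) = 0 := by
    rw [integral_sub hψ_int (hρ_int.const_mul m), integral_const_mul, hρ1, mul_one, sub_self]
  obtain ⟨φ, hφ, hφc, hφd⟩ := HasCompactSupport.exists_deriv_eq_of_integral_eq_zero
    (hψc.sub hmρc) (hψ.sub (contDiff_const.mul hρ)) hzero
  have key := hd φ hφ hφc
  simp only [hφd, Pi.sub_apply, sub_smul, mul_smul] at key
  rw [integral_sub hψh (hρh.fun_smul m), integral_smul, sub_eq_zero] at key
  rw [key, integral_smul_const]

/-- If the distributional derivative of a locally integrable function `f` is a locally integrable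
function `g`, then `f` agrees a.e. with a primitive of `g`. -/
theorem MeasureTheory.LocallyIntegrable.ae_eq_const_add_primitive [CompleteSpace E]
    {f g : ℝ → E} (hf : LocallyIntegrable f volume) (hg : LocallyIntegrable g volume)
    (hd : ∀ φ : ℝ → ℝ, ContDiff ℝ (⊤ : ℕ∞) φ → HasCompactSupport φ →
      ∫ t, deriv φ t • f t = -∫ t, φ t • g t) :
    ∃ c : E, ∀ᵐ t, f t = c + ∫ s in 0..t, g s := by
  have hG : LocallyIntegrable (fun t ↦ ∫ s in 0..t, g s) volume :=
    (intervalIntegral.continuous_primitive hg.intervalIntegrable 0).locallyIntegrable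
  obtain ⟨c, hc⟩ := (hf.sub hG).ae_eq_const_of_integral_deriv_smul_eq_zero fun φ hφ hφc ↦ by
    have hφ' : Continuous (deriv φ) := hφ.continuous_deriv (mod_cast le_top)
    simp only [Pi.sub_apply, smul_sub]
    rw [integral_sub (hf.integrable_smul_left_of_hasCompactSupport hφ' hφc.deriv)
      (hG.integrable_smul_left_of_hasCompactSupport hφ' hφc.deriv), hd φ hφ hφc,
      hg.integral_deriv_smul_primitive 0 (hφ.of_le (mod_cast le_top)) hφc, sub_self]
  refine ⟨c, hc.mono fun t ht ↦ ?_⟩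
  rw [← ht, Pi.sub_apply, sub_add_cancel]

/-- If a function takes values in a closed subspace, then so does its derivative. -/
theorem HasDerivAt.mem_of_forall_mem {F : ℝ → E} {F' : E} {x : ℝ} (hF : HasDerivAt F F' x)
    {S : Submodule ℝ E} (hS : IsClosed (S : Set E)) (hmem : ∀ t, F t ∈ S) : F' ∈ S :=
  hS.mem_of_tendsto hF.tendsto_slope (Eventually.of_forall fun y ↦ by
    rw [slope_def_module]
    exact S.smul_mem _ (S.sub_mem (hmem y) (hmem x)))

end DuBoisReymond

/-- Let `Y ↪ X` be Banach spaces and `C` a closed linear operator on `X`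
whose domain (with the graph norm) contains `Y` continuously. If `u ∈ L¹_loc(ℝ; Y)` is such
that the distributional derivatives `∂u` and `∂(Cu)` are regular `X`-valued distributions
(represented by `v, w ∈ L¹_loc(ℝ; X)`), then (after modification on a null set) for a.e.
`t ∈ ℝ` the strong derivative `u'(t)` exists in `X`, belongs to the domain of `C`, and
`C u'(t) = (∂(Cu))(t)`. -/
theorem statement13 (X Y : Type*)
    [NormedAddCommGroup X] [NormedSpace ℝ X] [CompleteSpace X]
    [NormedAddCommGroup Y] [NormedSpace ℝ Y] [CompleteSpace Y]
    (J : Y →L[ℝ] X) (hJ : Function.Injective J)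
    (C : X →ₗ.[ℝ] X) (hC : C.IsClosed)
    (hdom : ∀ y : Y, J y ∈ C.domain)
    (hgraph : ∃ K : ℝ, ∀ y : Y, ‖J y‖ + ‖C ⟨J y, hdom y⟩‖ ≤ K * ‖y‖)
    (u : ℝ → Y) (v w : ℝ → X)
    (hu : LocallyIntegrable u volume)
    (hJu : LocallyIntegrable (fun t => J (u t)) volume)
    (hCu : LocallyIntegrable (fun t => C ⟨J (u t), hdom (u t)⟩) volume)
    (hv : LocallyIntegrable v volume) (hw : LocallyIntegrable w volume)
    (hdu : ∀ φ : ℝ → ℝ, ContDiff ℝ (⊤ : ℕ∞) φ → HasCompactSupport φ →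
      ∫ t, deriv φ t • J (u t) = - ∫ t, φ t • v t)
    (hdCu : ∀ φ : ℝ → ℝ, ContDiff ℝ (⊤ : ℕ∞) φ → HasCompactSupport φ →
      ∫ t, deriv φ t • (C ⟨J (u t), hdom (u t)⟩ : X) = - ∫ t, φ t • w t) :
    ∃ uu : ℝ → X, (uu =ᵐ[volume] fun t => J (u t)) ∧
      ∀ᵐ t ∂volume, HasDerivAt uu (v t) t ∧
        ∃ h : v t ∈ C.domain, C ⟨v t, h⟩ = w t := by
  have hf : LocallyIntegrable (fun t ↦ (J (u t), C ⟨J (u t), hdom (u t)⟩)) volume :=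
    hJu.prodMk hCu
  have hg : LocallyIntegrable (fun t ↦ (v t, w t)) volume := hv.prodMk hw
  obtain ⟨c, hc⟩ := hf.ae_eq_const_add_primitive hg fun φ hφ hφc ↦ by
    have hφ' : Continuous (deriv φ) := hφ.continuous_deriv (mod_cast le_top)
    simp only [Prod.smul_mk]
    rw [integral_pair (hJu.integrable_smul_left_of_hasCompactSupport hφ' hφc.deriv)
        (hCu.integrable_smul_left_of_hasCompactSupport hφ' hφc.deriv),
      integral_pair (hv.integrable_smul_left_of_hasCompactSupport hφ.continuous hφc)
        (hw.integrable_smul_left_of_hasCompactSupport hφ.continuous hφc),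
      hdu φ hφ hφc, hdCu φ hφ hφc, Prod.neg_mk]
  set F : ℝ → X × X := fun t ↦ c + ∫ s in 0..t, (v s, w s)
  have hFcont : Continuous F :=
    continuous_const.add (intervalIntegral.continuous_primitive hg.intervalIntegrable 0)
  have hmem : ∀ t, F t ∈ C.graph := by
    have hae : ∀ᵐ t, t ∈ F ⁻¹' (C.graph : Set (X × X)) := hc.mono fun t ht ↦ by
      change c + _ ∈ C.graph
      rw [← ht]
      exact C.mem_graph ⟨J (u t), hdom (u t)⟩
    intro t
    have hclosed : IsClosed (F ⁻¹' (C.graph : Set (X × X))) := hC.preimage hFcont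
    exact hclosed.closure_subset (Measure.dense_of_ae hae t)
  refine ⟨fun t ↦ (F t).1, hc.mono fun t ht ↦ (congrArg Prod.fst ht).symm, ?_⟩
  filter_upwards [_root_.LocallyIntegrable.ae_hasDerivAt_integral hg] with t ht
  have hFt : HasDerivAt F (v t, w t) t := (ht 0).const_add c
  refine ⟨hFt.fst, ?_⟩
  obtain ⟨y, hy₁, hy₂⟩ := C.mem_graph_iff.mp (hFt.mem_of_forall_mem hC hmem)
  obtain ⟨y, hy⟩ := y
  obtain rfl : y = v t := hy₁
  exact ⟨hy, hy₂⟩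
end
end
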